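/- Let R^9 be the profile ≽_1: a,c,{b,d}; ≽_2: {b,d},{a,c}; ≽_3: a,d,{b,c}; ≽_4: {b,c},a,d. Then f(R^9)(a) = 1/2 and f(R^9)(c) = 0. -/

import Mathlib

open Finset
open scoped Classical

section Framework

variable {A : Type*} [Fintype A] {n : ℕ}

/-- `p` is a lottery (probability distribution) on the set of alternatives `A`. -/
def IsLottery (p : A → ℝ) : Prop := (∀ x, 0 ≤ p x) ∧ ∑ x, p x = 1

/-- `r` is a weak preference relation: complete (total) and transitive. -/
def IsPref (r : A → A → Prop) : Prop := Total r ∧ Transitive r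

/-- A preference profile assigns a weak preference relation to each of the `n` agents. -/
def IsProfile (R : Fin n → A → A → Prop) : Prop := ∀ i, IsPref (R i)

/-- The probability that `p` assigns to alternatives weakly preferred (by `r`) to `x`. -/
noncomputable def upperProb (r : A → A → Prop) (p : A → ℝ) (x : A) : ℝ :=
  ∑ y ∈ univ.filter (fun y => r y x), p y

/-- Stochastic dominance: `p ≽^sd q` w.r.t. the preference relation `r`. -/
def SDge (r : A → A → Prop) (p q : A → ℝ) : Prop :=
  ∀ x, upperProb r q x ≤ upperProb r p x

/-- Strict stochastic dominance: `p ≻^sd q` w.r.t. the preference relation `r`. -/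
def SDgt (r : A → A → Prop) (p q : A → ℝ) : Prop :=
  SDge r p q ∧ ¬ SDge r q p

/-- A social decision scheme maps every preference profile to a lottery. -/
def IsSDS (f : (Fin n → A → A → Prop) → (A → ℝ)) : Prop :=
  ∀ R : Fin n → A → A → Prop, IsProfile R → IsLottery (f R)

/-- Anonymity: invariance under permutations of the agents. -/
def Anonymous (f : (Fin n → A → A → Prop) → (A → ℝ)) : Prop :=
  ∀ R : Fin n → A → A → Prop, IsProfile R → ∀ π : Equiv.Perm (Fin n),
    f (fun i => R (π i)) = f R

/-- Neutrality: `f(R^σ)(σ x) = f(R)(x)`, where `R^σ` relabels alternatives by `σ`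
(i.e. `σ x ≽^σ_i σ y ↔ x ≽_i y`). -/
def Neutral (f : (Fin n → A → A → Prop) → (A → ℝ)) : Prop :=
  ∀ R : Fin n → A → A → Prop, IsProfile R → ∀ σ : Equiv.Perm A, ∀ x : A,
    f (fun i u v => R i (σ.symm u) (σ.symm v)) (σ x) = f R x

/-- The lottery `p` is sd-efficient for the profile `R`: no lottery `q` is weakly
sd-preferred to `p` by all agents and strictly sd-preferred by some agent. -/
def SDEfficientLottery (R : Fin n → A → A → Prop) (p : A → ℝ) : Prop :=
  ¬ ∃ q : A → ℝ, IsLottery q ∧ (∀ i, SDge (R i) q p) ∧ (∃ i, SDgt (R i) q p)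

/-- sd-efficiency of a social decision scheme. -/
def SDEfficient (f : (Fin n → A → A → Prop) → (A → ℝ)) : Prop :=
  ∀ R : Fin n → A → A → Prop, IsProfile R → SDEfficientLottery R (f R)

/-- sd-strategyproofness: no agent can misreport and obtain a strictly
sd-preferred lottery. -/
def SDStrategyproof (f : (Fin n → A → A → Prop) → (A → ℝ)) : Prop :=
  ∀ R R' : Fin n → A → A → Prop, IsProfile R → IsProfile R' → ∀ i : Fin n,
    (∀ j, j ≠ i → R j = R' j) → ¬ SDgt (R i) (f R') (f R)

/-- `x` is the unique most-preferred alternative of the relation `r`. -/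
def UniqueTop (r : A → A → Prop) (x : A) : Prop :=
  ∀ y, y ≠ x → r x y ∧ ¬ r y x

/-- `f` extends random dictatorship: whenever every agent has a unique top choice,
each alternative gets probability (number of agents having it as top)/n. -/
def ExtendsRD (f : (Fin n → A → A → Prop) → (A → ℝ)) : Prop :=
  ∀ R : Fin n → A → A → Prop, IsProfile R →
    ∀ t : Fin n → A, (∀ i, UniqueTop (R i) (t i)) →
      ∀ x : A, f R x = ((univ.filter (fun i => t i = x)).card : ℝ) / (n : ℝ)

/-- `x` is Pareto-dominated in the profile `R`. -/
def Pareto_Dominated (R : Fin n → A → A → Prop) (x : A) : Prop :=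
  ∃ y : A, (∀ i, R i y x) ∧ ∃ i, R i y x ∧ ¬ R i x y

end Framework

/-! Concrete setting: alternatives `A = {a,b,c,d}` encoded as `Fin 4`. -/

/-- The alternative `a`. -/ def a : Fin 4 := 0
/-- The alternative `b`. -/ def b : Fin 4 := 1
/-- The alternative `c`. -/ def c : Fin 4 := 2
/-- The alternative `d`. -/ def d : Fin 4 := 3

/-- The weak preference relation induced by a rank function over `(a,b,c,d)`
(lower rank = more preferred; equal ranks = indifference). -/
def pr (rk : Fin 4 → ℕ) : Fin 4 → Fin 4 → Prop := fun x y => rk x ≤ rk y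


/-- The profile `R9`: ≽₁: a,c,{b,d}; ≽₂: {b,d},{a,c}; ≽₃: a,d,{b,c}; ≽₄: {b,c},a,d. -/
def R9 : Fin 4 → Fin 4 → Fin 4 → Prop :=
  ![pr ![0,2,1,2], pr ![1,0,1,0], pr ![0,2,2,1], pr ![1,0,0,2]]

/-- The profile whose agents rank the alternatives according to the rows of `K`. -/
def rankProfile (K : Fin 4 → Fin 4 → ℕ) : Fin 4 → Fin 4 → Fin 4 → Prop := fun i => pr (K i)

theorem isProfile_rankProfile (K : Fin 4 → Fin 4 → ℕ) : IsProfile (rankProfile K) := fun _ =>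
  ⟨fun _ _ => le_total _ _, fun _ _ _ h h' => le_trans h h'⟩

theorem upperProb_pr (k : Fin 4 → ℕ) (p : Fin 4 → ℝ) (x : Fin 4) :
    upperProb (pr k) p x = ∑ y, if k y ≤ k x then p y else 0 := by
  rw [upperProb, sum_filter]
  refine sum_congr rfl fun y _ => ?_
  simp only [pr]
  congr

theorem sdge_pr_iff (k : Fin 4 → ℕ) (p q : Fin 4 → ℝ) :
    SDge (pr k) p q ↔
      ∀ x, (∑ y, if k y ≤ k x then q y else 0) ≤ ∑ y, if k y ≤ k x then p y else 0 := by
  simp only [SDge, upperProb_pr]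

section Consequences

variable {f : (Fin 4 → Fin 4 → Fin 4 → Prop) → (Fin 4 → ℝ)}

theorem IsSDS.nonneg_and_sum_eq_one (hf : IsSDS f) (K : Fin 4 → Fin 4 → ℕ) :
    (0 ≤ f (rankProfile K) 0 ∧ 0 ≤ f (rankProfile K) 1 ∧ 0 ≤ f (rankProfile K) 2 ∧
      0 ≤ f (rankProfile K) 3) ∧
    f (rankProfile K) 0 + f (rankProfile K) 1 + f (rankProfile K) 2 + f (rankProfile K) 3 = 1 := by
  obtain ⟨h, hs⟩ := hf _ (isProfile_rankProfile K)
  rw [Fin.sum_univ_four] at hs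
  exact ⟨⟨h 0, h 1, h 2, h 3⟩, hs⟩

/-- A manipulation that does not hurt the agent does not help either. -/
theorem SDStrategyproof.sdge_of_sdge (hsp : SDStrategyproof f) (K K' : Fin 4 → Fin 4 → ℕ)
    (i : Fin 4) (hK : ∀ j, j ≠ i → K j = K' j)
    (h : SDge (pr (K i)) (f (rankProfile K')) (f (rankProfile K))) :
    SDge (pr (K i)) (f (rankProfile K)) (f (rankProfile K')) := by
  by_contra hn
  exact hsp _ _ (isProfile_rankProfile K) (isProfile_rankProfile K') i
    (fun j hj => congrArg pr (hK j hj)) ⟨h, hn⟩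

/-- An automorphism `(π, σ)` of the profile leaves the lottery invariant under `σ`. -/
theorem apply_eq_of_automorphism (han : Anonymous f) (hneu : Neutral f)
    (K : Fin 4 → Fin 4 → ℕ) (π σ : Equiv.Perm (Fin 4))
    (hK : ∀ i x, K i (σ.symm x) = K (π i) x) (x : Fin 4) :
    f (rankProfile K) (σ x) = f (rankProfile K) x := by
  have h : (fun i u v => rankProfile K i (σ.symm u) (σ.symm v)) =
      fun i => rankProfile K (π i) := by
    funext i u v
    simp only [rankProfile, pr, hK]
  rw [← hneu _ (isProfile_rankProfile K) σ x, h, han _ (isProfile_rankProfile K) π]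

/-- If no agent is hurt by the transfer of `δ` from `d` to `a` and of `γ` from `c` to `b`, then
no agent strictly benefits from it. -/
theorem SDEfficient.sdge_of_transfer (heff : SDEfficient f) {K : Fin 4 → Fin 4 → ℕ}
    {p : Fin 4 → ℝ} (hp : f (rankProfile K) = p) (hl : IsLottery p) {γ δ : ℝ} (hγ : 0 ≤ γ)
    (hδ : 0 ≤ δ) (hγp : γ ≤ p 2) (hδp : δ ≤ p 3)
    (h : ∀ i, SDge (pr (K i)) ![p 0 + δ, p 1 + γ, p 2 - γ, p 3 - δ] p) (i : Fin 4) :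
    SDge (pr (K i)) p ![p 0 + δ, p 1 + γ, p 2 - γ, p 3 - δ] := by
  subst hp
  by_contra hn
  refine heff _ (isProfile_rankProfile K) ⟨_, ⟨fun x => ?_, ?_⟩, h, i, h i, hn⟩
  · have h0 := hl.1 0
    have h1 := hl.1 1
    fin_cases x <;> simp <;> linarith
  · rw [← hl.2]
    simp [Fin.sum_univ_four]
    ring

end Consequences

/-- The profile `R9` in terms of rank functions. -/
def ranksR9 : Fin 4 → Fin 4 → ℕ :=
  ![![0, 2, 1, 2], ![1, 0, 1, 0], ![0, 2, 2, 1], ![1, 0, 0, 2]]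

/-- `R9` with the third relation replaced by `{a,d},b,c`. -/
def ranksThird : Fin 4 → Fin 4 → ℕ :=
  ![![0, 2, 1, 2], ![1, 0, 1, 0], ![0, 1, 2, 0], ![1, 0, 0, 2]]

/-- `R9` with the first and third relations replaced by `{a,c},{b,d}` and `{a,d},b,c`. -/
def ranksFirstThird : Fin 4 → Fin 4 → ℕ :=
  ![![0, 1, 0, 1], ![1, 0, 1, 0], ![0, 1, 2, 0], ![1, 0, 0, 2]]

/-- `R9` with the second relation replaced by `{b,d},a,c`. -/
def ranksSecond : Fin 4 → Fin 4 → ℕ :=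
  ![![0, 2, 1, 2], ![1, 0, 2, 0], ![0, 2, 2, 1], ![1, 0, 0, 2]]

/-- `R9` with the first two relations replaced by `a,{b,c,d}` and `{b,d},a,c`. -/
def ranksFirstSecond : Fin 4 → Fin 4 → ℕ :=
  ![![0, 1, 1, 1], ![1, 0, 2, 0], ![0, 2, 2, 1], ![1, 0, 0, 2]]

/-- `R9` with the first two relations replaced by `a,{b,c,d}` and `b,{a,c,d}`. -/
def ranksTops : Fin 4 → Fin 4 → ℕ :=
  ![![0, 1, 1, 1], ![1, 0, 1, 1], ![0, 2, 2, 1], ![1, 0, 0, 2]]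

/-- `R9` with all relations but the third replaced by `a,{b,c,d}`, `b,{a,c,d}` and
`b,c,{a,d}`. -/
def ranksTopsFourth : Fin 4 → Fin 4 → ℕ :=
  ![![0, 1, 1, 1], ![1, 0, 1, 1], ![0, 2, 2, 1], ![2, 0, 1, 2]]

section Profiles

variable {f : (Fin 4 → Fin 4 → Fin 4 → Prop) → (Fin 4 → ℝ)}

theorem apply_ranksFirstThird (hf : IsSDS f) (han : Anonymous f) (hneu : Neutral f)
    (heff : SDEfficient f) :
    f (rankProfile ranksFirstThird) 0 = 1/2 ∧ f (rankProfile ranksFirstThird) 1 = 1/2 ∧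
      f (rankProfile ranksFirstThird) 2 = 0 ∧ f (rankProfile ranksFirstThird) 3 = 0 := by
  have aut := apply_eq_of_automorphism han hneu ranksFirstThird
    (Equiv.swap 0 1 * Equiv.swap 2 3) (Equiv.swap 0 1 * Equiv.swap 2 3) (by decide)
  have hab : f (rankProfile ranksFirstThird) 1 = f (rankProfile ranksFirstThird) 0 := aut 0
  have hcd : f (rankProfile ranksFirstThird) 3 = f (rankProfile ranksFirstThird) 2 := aut 2
  clear aut
  obtain ⟨⟨h0, h1, h2, h3⟩, hs⟩ := hf.nonneg_and_sum_eq_one ranksFirstThird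
  have hl := hf _ (isProfile_rankProfile ranksFirstThird)
  generalize hp : f (rankProfile ranksFirstThird) = p at *
  have e := heff.sdge_of_transfer hp hl h2 h3 le_rfl le_rfl (by
      intro i
      fin_cases i <;>
        simp [ranksFirstThird, sdge_pr_iff, Fin.forall_fin_succ, Fin.sum_univ_four] <;>
        grind) 2
  simp [ranksFirstThird, sdge_pr_iff, Fin.forall_fin_succ, Fin.sum_univ_four] at e
  grind

theorem apply_ranksThird (hf : IsSDS f) (han : Anonymous f) (hneu : Neutral f)
    (heff : SDEfficient f) (hsp : SDStrategyproof f) :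
    f (rankProfile ranksThird) 0 = 1/2 ∧ f (rankProfile ranksThird) 2 = 0 := by
  obtain ⟨k0, -, k2, -⟩ := apply_ranksFirstThird hf han hneu heff
  obtain ⟨-, ls⟩ := hf.nonneg_and_sum_eq_one ranksFirstThird
  obtain ⟨⟨h0, h1, h2, h3⟩, hs⟩ := hf.nonneg_and_sum_eq_one ranksThird
  have s := hsp.sdge_of_sdge ranksThird ranksFirstThird 0 (by decide)
  have t := hsp.sdge_of_sdge ranksFirstThird ranksThird 0 (by decide)
  generalize f (rankProfile ranksThird) = p at *
  generalize f (rankProfile ranksFirstThird) = q at *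
  simp [ranksThird, ranksFirstThird, sdge_pr_iff, Fin.forall_fin_succ, Fin.sum_univ_four] at s t
  grind

theorem half_le_apply_ranksR9 (hf : IsSDS f) (han : Anonymous f) (hneu : Neutral f)
    (heff : SDEfficient f) (hsp : SDStrategyproof f) :
    1/2 ≤ f (rankProfile ranksR9) 0 := by
  obtain ⟨k0, k2⟩ := apply_ranksThird hf han hneu heff hsp
  obtain ⟨⟨l0, l1, l2, l3⟩, ls⟩ := hf.nonneg_and_sum_eq_one ranksThird
  obtain ⟨⟨h0, h1, h2, h3⟩, hs⟩ := hf.nonneg_and_sum_eq_one ranksR9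
  have hl := hf _ (isProfile_rankProfile ranksR9)
  have s := hsp.sdge_of_sdge ranksR9 ranksThird 2 (by decide)
  have t := hsp.sdge_of_sdge ranksThird ranksR9 2 (by decide)
  generalize hp : f (rankProfile ranksR9) = p at *
  have hm := le_min h2 h3
  have e := heff.sdge_of_transfer hp hl hm hm (min_le_left _ _) (min_le_right _ _) (by
      intro i
      fin_cases i <;>
        simp [ranksR9, sdge_pr_iff, Fin.forall_fin_succ, Fin.sum_univ_four] <;>
        grind) 0
  generalize f (rankProfile ranksThird) = q at *
  simp [ranksR9, ranksThird, sdge_pr_iff, Fin.forall_fin_succ, Fin.sum_univ_four] at s t e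
  grind

theorem apply_ranksTopsFourth (hf : IsSDS f) (han : Anonymous f) (hneu : Neutral f)
    (heff : SDEfficient f) :
    f (rankProfile ranksTopsFourth) 1 = 1/2 ∧ f (rankProfile ranksTopsFourth) 2 = 0 ∧
      f (rankProfile ranksTopsFourth) 3 = 0 := by
  have aut := apply_eq_of_automorphism han hneu ranksTopsFourth
    (Equiv.swap 0 1 * Equiv.swap 2 3) (Equiv.swap 0 1 * Equiv.swap 2 3) (by decide)
  have hab : f (rankProfile ranksTopsFourth) 1 = f (rankProfile ranksTopsFourth) 0 := aut 0
  have hcd : f (rankProfile ranksTopsFourth) 3 = f (rankProfile ranksTopsFourth) 2 := aut 2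
  clear aut
  obtain ⟨⟨h0, h1, h2, h3⟩, hs⟩ := hf.nonneg_and_sum_eq_one ranksTopsFourth
  have hl := hf _ (isProfile_rankProfile ranksTopsFourth)
  generalize hp : f (rankProfile ranksTopsFourth) = p at *
  have e := heff.sdge_of_transfer hp hl h2 h3 le_rfl le_rfl (by
      intro i
      fin_cases i <;>
        simp [ranksTopsFourth, sdge_pr_iff, Fin.forall_fin_succ, Fin.sum_univ_four] <;>
        grind) 0
  simp [ranksTopsFourth, sdge_pr_iff, Fin.forall_fin_succ, Fin.sum_univ_four] at e
  grind

theorem apply_ranksTops (hf : IsSDS f) (han : Anonymous f) (hneu : Neutral f)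
    (heff : SDEfficient f) (hsp : SDStrategyproof f) :
    f (rankProfile ranksTops) 1 = 1/2 ∧ f (rankProfile ranksTops) 2 = 0 ∧
      f (rankProfile ranksTops) 3 = 0 := by
  obtain ⟨k1, k2, k3⟩ := apply_ranksTopsFourth hf han hneu heff
  obtain ⟨-, ls⟩ := hf.nonneg_and_sum_eq_one ranksTopsFourth
  obtain ⟨⟨h0, h1, h2, h3⟩, hs⟩ := hf.nonneg_and_sum_eq_one ranksTops
  have hl := hf _ (isProfile_rankProfile ranksTops)
  have s := hsp.sdge_of_sdge ranksTops ranksTopsFourth 3 (by decide)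
  have t := hsp.sdge_of_sdge ranksTopsFourth ranksTops 3 (by decide)
  generalize hp : f (rankProfile ranksTops) = p at *
  have e := heff.sdge_of_transfer hp hl h2 h3 le_rfl le_rfl (by
      intro i
      fin_cases i <;>
        simp [ranksTops, sdge_pr_iff, Fin.forall_fin_succ, Fin.sum_univ_four] <;>
        grind)
  have e₀ := e 0
  have e₁ := e 1
  clear e
  generalize f (rankProfile ranksTopsFourth) = q at *
  simp [ranksTops, ranksTopsFourth, sdge_pr_iff, Fin.forall_fin_succ, Fin.sum_univ_four]
    at s t e₀ e₁
  grind

theorem apply_ranksFirstSecond_le (hf : IsSDS f) (han : Anonymous f) (hneu : Neutral f)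
    (heff : SDEfficient f) (hsp : SDStrategyproof f) :
    f (rankProfile ranksFirstSecond) 0 ≤ 1/2 := by
  obtain ⟨k1, k2, k3⟩ := apply_ranksTops hf han hneu heff hsp
  obtain ⟨-, ls⟩ := hf.nonneg_and_sum_eq_one ranksTops
  obtain ⟨⟨h0, h1, h2, h3⟩, hs⟩ := hf.nonneg_and_sum_eq_one ranksFirstSecond
  have s := hsp.sdge_of_sdge ranksFirstSecond ranksTops 1 (by decide)
  generalize f (rankProfile ranksFirstSecond) = p at *
  generalize f (rankProfile ranksTops) = q at *
  simp [ranksFirstSecond, sdge_pr_iff, Fin.forall_fin_succ, Fin.sum_univ_four] at s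
  grind

theorem apply_ranksSecond (hf : IsSDS f) (han : Anonymous f) (hneu : Neutral f)
    (heff : SDEfficient f) (hsp : SDStrategyproof f) :
    f (rankProfile ranksSecond) 0 ≤ 1/2 ∧ f (rankProfile ranksSecond) 2 = 0 ∧
      f (rankProfile ranksSecond) 3 = 0 := by
  have k := apply_ranksFirstSecond_le hf han hneu heff hsp
  have hcd : f (rankProfile ranksSecond) 3 = f (rankProfile ranksSecond) 2 :=
    apply_eq_of_automorphism han hneu ranksSecond
      (Equiv.swap 0 2 * Equiv.swap 1 3) (Equiv.swap 2 3) (by decide) 2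
  obtain ⟨⟨l0, l1, l2, l3⟩, ls⟩ := hf.nonneg_and_sum_eq_one ranksFirstSecond
  obtain ⟨⟨h0, h1, h2, h3⟩, hs⟩ := hf.nonneg_and_sum_eq_one ranksSecond
  have hl := hf _ (isProfile_rankProfile ranksSecond)
  have t := hsp.sdge_of_sdge ranksFirstSecond ranksSecond 0 (by decide)
  generalize hp : f (rankProfile ranksSecond) = p at *
  have e := heff.sdge_of_transfer hp hl h2 h3 le_rfl le_rfl (by
      intro i
      fin_cases i <;>
        simp [ranksSecond, sdge_pr_iff, Fin.forall_fin_succ, Fin.sum_univ_four] <;>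
        grind) 0
  generalize f (rankProfile ranksFirstSecond) = q at *
  simp [ranksSecond, ranksFirstSecond, sdge_pr_iff, Fin.forall_fin_succ, Fin.sum_univ_four] at t e
  grind

theorem apply_ranksR9_add_le (hf : IsSDS f) (han : Anonymous f) (hneu : Neutral f)
    (heff : SDEfficient f) (hsp : SDStrategyproof f) :
    f (rankProfile ranksR9) 0 + f (rankProfile ranksR9) 2 ≤ 1/2 := by
  obtain ⟨k0, k2, k3⟩ := apply_ranksSecond hf han hneu heff hsp
  obtain ⟨-, ls⟩ := hf.nonneg_and_sum_eq_one ranksSecond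
  obtain ⟨-, hs⟩ := hf.nonneg_and_sum_eq_one ranksR9
  have s := hsp.sdge_of_sdge ranksR9 ranksSecond 1 (by decide)
  generalize f (rankProfile ranksR9) = p at *
  generalize f (rankProfile ranksSecond) = q at *
  simp [ranksR9, sdge_pr_iff, Fin.forall_fin_succ, Fin.sum_univ_four] at s
  grind

end Profiles

theorem rankProfile_ranksR9 : rankProfile ranksR9 = R9 := by
  funext i
  fin_cases i <;> rfl

theorem stmt12 (f : (Fin 4 → Fin 4 → Fin 4 → Prop) → (Fin 4 → ℝ))
    (hf : IsSDS f) (han : Anonymous f) (hneu : Neutral f)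
    (heff : SDEfficient f) (hsp : SDStrategyproof f) :
    f R9 a = 1/2 ∧ f R9 c = 0 := by
  have h₁ := half_le_apply_ranksR9 hf han hneu heff hsp
  have h₂ := apply_ranksR9_add_le hf han hneu heff hsp
  obtain ⟨⟨-, -, h₃, -⟩, -⟩ := hf.nonneg_and_sum_eq_one ranksR9
  rw [rankProfile_ranksR9] at h₁ h₂ h₃
  change f R9 0 = 1/2 ∧ f R9 2 = 0
  constructor <;> linarith
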